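/- arXiv:2106.14816 — 2 statements merged into one kernel-verified Lean document; each statement's English description precedes it below -/
import Mathlib

section
/- Let p > 1 be a real number and consider a 2-value instance where each u_i(g) ∈ {1, p}. Define rounded utilities u' by u'_i(g) = 1 when u_i(g) = 1, and, when u_i(g) = p, u'_i(g) = ⌊p⌋ if ⌊p⌋/p ≥ p/⌈p⌉ and u'_i(g) = ⌈p⌉ otherwise. Set ρ = max{⌊p⌋/p, p/⌈p⌉}. Then every complete allocation A that maximizes Π_{i=1}^n u'_i(A_i) over complete allocations satisfies Π_{i=1}^n u_i(A_i) ≥ ρ^n · Π_{i=1}^n u_i(B_i) for every complete allocation B; that is, A is a ρ-approximation of the maximum Nash social welfare with respect to u. -/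
open Finset

/-- An allocation assigns each good to at most one agent (`none` = unallocated). -/
abbrev Alloc (n m : ℕ) := Fin m → Option (Fin n)

/-- The bundle `A_i` of agent `i` in allocation `A`. -/
def bundle {n m : ℕ} (A : Alloc n m) (i : Fin n) : Finset (Fin m) :=
  Finset.univ.filter fun g => A g = some i

/-- `util u A i = u_i(A_i)` for real-valued utilities. -/
def util {n m : ℕ} (u : Fin n → Fin m → ℝ) (A : Alloc n m) (i : Fin n) : ℝ :=
  ∑ g ∈ bundle A i, u i g

/-- An allocation is complete if every good is allocated. -/
def Complete {n m : ℕ} (A : Alloc n m) : Prop := ∀ g, (A g).isSome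

/-- The product of the bundle utilities (the `n`-th power of the NSW). -/
def nswProd {n m : ℕ} (u : Fin n → Fin m → ℝ) (A : Alloc n m) : ℝ :=
  ∏ i, util u A i

theorem prod_scale_le {n m : ℕ} (v w : Fin n → Fin m → ℝ) (c : ℝ) (hc : 0 ≤ c)
    (hv : ∀ i g, 0 ≤ v i g) (h : ∀ i g, c * v i g ≤ w i g) (A : Alloc n m) :
    c ^ n * nswProd v A ≤ nswProd w A := by
  have e : c ^ n * nswProd v A = ∏ i, (c * util v A i) := by
    rw [Finset.prod_mul_distrib]; simp [nswProd]
  rw [e]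
  refine Finset.prod_le_prod (fun i _ => mul_nonneg hc (Finset.sum_nonneg fun g _ => hv i g))
    (fun i _ => ?_)
  unfold util
  rw [Finset.mul_sum]
  exact Finset.sum_le_sum fun g _ => h i g

/-- Rounding a 2-value instance `{1, p}` (real `p > 1`) to the integral 2-value
instance `{1, ⌊p⌋}` or `{1, ⌈p⌉}` (whichever ratio is better) and maximizing the
product of rounded utilities yields a `max{⌊p⌋/p, p/⌈p⌉}`-approximation of the
maximum Nash social welfare: the product of true utilities of the resulting
allocation is at least `ρ^n` times the optimal product. -/
theorem stmt12 (n m : ℕ) (hn : 0 < n) (p : ℝ) (hp : 1 < p)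
    (u : Fin n → Fin m → ℝ) (h2 : ∀ i g, u i g = 1 ∨ u i g = p)
    (u' : Fin n → Fin m → ℝ)
    (hu'light : ∀ i g, u i g = 1 → u' i g = 1)
    (hu'heavy : ∀ i g, u i g = p →
      u' i g = if (⌊p⌋ : ℝ) / p ≥ p / (⌈p⌉ : ℝ) then (⌊p⌋ : ℝ) else (⌈p⌉ : ℝ))
    (A : Alloc n m) (hA : Complete A)
    (hAmax : ∀ B : Alloc n m, Complete B → nswProd u' B ≤ nswProd u' A) :
    ∀ B : Alloc n m, Complete B →
      (max ((⌊p⌋ : ℝ) / p) (p / (⌈p⌉ : ℝ))) ^ n * nswProd u B ≤ nswProd u A := by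
  intro B hB
  have hp0 : 0 < p := by linarith
  have hf1 : (1 : ℝ) ≤ (⌊p⌋ : ℝ) := by
    exact_mod_cast Int.le_floor.mpr (by simpa using hp.le)
  have hfp : (⌊p⌋ : ℝ) ≤ p := Int.floor_le p
  have hpc : p ≤ (⌈p⌉ : ℝ) := Int.le_ceil p
  have hc0 : (0 : ℝ) < (⌈p⌉ : ℝ) := by linarith
  have hu0 : ∀ i g, 0 ≤ u i g := by
    intro i g
    rcases h2 i g with h | h <;> rw [h] <;> linarith
  have hu'0 : ∀ i g, 0 ≤ u' i g := by
    intro i g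
    rcases h2 i g with h | h
    · rw [hu'light i g h]; norm_num
    · rw [hu'heavy i g h]; split_ifs <;> linarith
  by_cases hcase : (⌊p⌋ : ℝ) / p ≥ p / (⌈p⌉ : ℝ)
  · rw [max_eq_left hcase]
    have h1 := prod_scale_le u u' ((⌊p⌋ : ℝ) / p) (by positivity) hu0 (by
      intro i g
      rcases h2 i g with h | h
      · rw [hu'light i g h, h, mul_one, div_le_one hp0]; exact hfp
      · rw [hu'heavy i g h, h, if_pos hcase, div_mul_cancel₀ _ hp0.ne']) B
    have h3 := prod_scale_le u' u 1 (by norm_num) hu'0 (by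
      intro i g
      rcases h2 i g with h | h
      · rw [hu'light i g h, h, mul_one]
      · rw [hu'heavy i g h, h, if_pos hcase, one_mul]; exact hfp) A
    rw [one_pow, one_mul] at h3
    exact h1.trans ((hAmax B hB).trans h3)
  · rw [max_eq_right (not_le.mp hcase).le]
    have h1 := prod_scale_le u u' 1 (by norm_num) hu0 (by
      intro i g
      rcases h2 i g with h | h
      · rw [hu'light i g h, h, mul_one]
      · rw [hu'heavy i g h, h, if_neg hcase, one_mul]; exact hpc) B
    have h3 := prod_scale_le u' u (p / (⌈p⌉ : ℝ)) (by positivity) hu'0 (by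
      intro i g
      rcases h2 i g with h | h
      · rw [hu'light i g h, h, mul_one, div_le_one hc0]; exact hpc
      · rw [hu'heavy i g h, h, if_neg hcase, div_mul_cancel₀ _ hc0.ne']) A
    rw [one_pow, one_mul] at h1
    exact (mul_le_mul_of_nonneg_left (h1.trans (hAmax B hB)) (by positivity)).trans h3
end

section
/- For every real number p ≥ 1, max{⌊p⌋/p, p/⌈p⌉} ≥ 1/√2. (Hence the rounding approximation factor max{⌊p⌋/p, p/⌈p⌉} is always at least 2^{-1/2}.) -/
/-- For every real `p ≥ 1`, the rounding approximation factor
`max{⌊p⌋/p, p/⌈p⌉}` is at least `1/√2 = 2^{-1/2}`. -/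
theorem stmt13 (p : ℝ) (hp : 1 ≤ p) :
    1 / Real.sqrt 2 ≤ max ((⌊p⌋ : ℝ) / p) (p / (⌈p⌉ : ℝ)) := by
  have hs : 0 < Real.sqrt 2 := by positivity
  have hs2 : Real.sqrt 2 * Real.sqrt 2 = 2 := Real.mul_self_sqrt (by norm_num)
  have hf : (1 : ℝ) ≤ (⌊p⌋ : ℝ) := by
    exact_mod_cast Int.le_floor.mpr (by simpa using hp)
  have hc : (⌈p⌉ : ℝ) ≤ (⌊p⌋ : ℝ) + 1 := by
    exact_mod_cast Int.ceil_le_floor_add_one p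
  have hpc : p ≤ (⌈p⌉ : ℝ) := Int.le_ceil p
  rw [le_max_iff]
  rcases le_total p (Real.sqrt 2 * (⌊p⌋ : ℝ)) with h | h
  · left
    rw [div_le_div_iff₀ hs (by linarith)]
    linarith
  · right
    rw [div_le_div_iff₀ hs (by linarith)]
    have h2 := mul_le_mul_of_nonneg_left h hs.le
    rw [← mul_assoc, hs2] at h2
    linarith
end
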